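/- Let K, Q be positive integers with Q ≤ K, and let a_{K−Q+1},…,a_K be nonnegative rational numbers with N := ∑_{u=K−Q+1}^{K} a_u > 0. Suppose ∑_{u=K−Q+1}^{K} u·a_u = r·N for some integer r with K−Q+1 ≤ r ≤ K. Then ∑_{u=K−Q+1}^{K} a_u · Z_K^Q(u) ≥ N · Z_K^Q(r). -/

import Mathlib

/-- The rational sequence `Z_K^Q(u)` from the paper:
`Z_K^Q(u) = ∑_{l=u+Q−K}^{min(u,Q)} ((Q−l)/(Q·l))·C(u,l)·C(K−u,Q−l)`. -/
def Z (K Q u : ℕ) : ℚ :=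
  ∑ l ∈ Finset.Icc (u + Q - K) (min u Q),
    (((Q : ℚ) - (l : ℚ)) / ((Q : ℚ) * (l : ℚ))) * (u.choose l : ℚ) *
      ((K - u).choose (Q - l) : ℚ)

/-- The Vandermonde-type sum `∑_{i+j=q} g(i)·C(n,i)·C(m,j)`. -/
def weightedVandermonde (g : ℕ → ℚ) (n m q : ℕ) : ℚ :=
  ∑ p ∈ Finset.HasAntidiagonal.antidiagonal q, g p.1 * (n.choose p.1 : ℚ) * (m.choose p.2 : ℚ)

theorem weightedVandermonde_succ_left (g : ℕ → ℚ) (n m q : ℕ) :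
    weightedVandermonde g (n + 1) m (q + 1) =
      weightedVandermonde g n m (q + 1) + weightedVandermonde (fun i => g (i + 1)) n m q := by
  simp only [weightedVandermonde, Finset.Nat.sum_antidiagonal_succ, Nat.choose_succ_succ,
    Nat.choose_zero_right, add_assoc, ← Finset.sum_add_distrib]
  congr 1
  refine Finset.sum_congr rfl fun p _ => ?_
  push_cast
  ring

theorem weightedVandermonde_succ_right (g : ℕ → ℚ) (n m q : ℕ) :
    weightedVandermonde g n (m + 1) (q + 1) =
      weightedVandermonde g n m (q + 1) + weightedVandermonde g n m q := by
  simp only [weightedVandermonde, Finset.Nat.sum_antidiagonal_succ', Nat.choose_succ_succ,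
    Nat.choose_zero_right, add_assoc, ← Finset.sum_add_distrib]
  congr 1
  refine Finset.sum_congr rfl fun p _ => ?_
  push_cast
  ring

theorem weightedVandermonde_second_difference (g : ℕ → ℚ) (n m q : ℕ) :
    weightedVandermonde g (n + 2) m (q + 2) - 2 * weightedVandermonde g (n + 1) (m + 1) (q + 2)
        + weightedVandermonde g n (m + 2) (q + 2) =
      weightedVandermonde (fun i => g (i + 2) - 2 * g (i + 1) + g i) n m q := by
  have hsplit : weightedVandermonde (fun i => g (i + 2) - 2 * g (i + 1) + g i) n m q =
      weightedVandermonde (fun i => g (i + 2)) n m q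
        - 2 * weightedVandermonde (fun i => g (i + 1)) n m q + weightedVandermonde g n m q := by
    simp only [weightedVandermonde, Finset.mul_sum, ← Finset.sum_sub_distrib,
      ← Finset.sum_add_distrib]
    exact Finset.sum_congr rfl fun p _ => by ring
  simp only [hsplit, weightedVandermonde_succ_left, weightedVandermonde_succ_right]
  ring

theorem Z_eq_weightedVandermonde {K Q u : ℕ} (hu : u ≤ K) :
    Z K Q u =
      weightedVandermonde (fun l => ((Q : ℚ) - (l : ℚ)) / ((Q : ℚ) * (l : ℚ))) u (K - u) Q := by
  rw [Z, weightedVandermonde, Finset.Nat.sum_antidiagonal_eq_sum_range_succ_mk]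
  refine Finset.sum_subset (fun l hl => ?_) fun l hl hl' => ?_
  · simp only [Finset.mem_Icc, Finset.mem_range] at *
    omega
  · simp only [Finset.mem_Icc, Finset.mem_range] at *
    rcases lt_or_ge u l with h | h
    · simp [Nat.choose_eq_zero_of_lt h]
    · have : K - u < Q - l := by omega
      simp [Nat.choose_eq_zero_of_lt this]

theorem Z_second_difference_nonneg {K Q u : ℕ} (hQK : Q ≤ K) (hu : K - Q + 1 ≤ u)
    (huK : u + 2 ≤ K) : Z K Q (u + 1) - Z K Q u ≤ Z K Q (u + 2) - Z K Q (u + 1) := by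
  obtain ⟨m, rfl⟩ : ∃ m, K = u + m + 2 := ⟨K - u - 2, by omega⟩
  obtain ⟨q, rfl⟩ : ∃ q, Q = q + 2 := ⟨Q - 2, by omega⟩
  rw [Z_eq_weightedVandermonde (by omega), Z_eq_weightedVandermonde (by omega),
    Z_eq_weightedVandermonde (by omega), show u + m + 2 - u = m + 2 by omega,
    show u + m + 2 - (u + 1) = m + 1 by omega, show u + m + 2 - (u + 2) = m by omega]
  rw [← sub_nonneg]
  refine le_of_le_of_eq ?_ ((weightedVandermonde_second_difference
    (fun l => (((q + 2 : ℕ) : ℚ) - (l : ℚ)) / (((q + 2 : ℕ) : ℚ) * (l : ℚ))) u m q).symm.trans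
      (by ring))
  refine Finset.sum_nonneg fun p hp => ?_
  have hpq := Finset.HasAntidiagonal.mem_antidiagonal.mp hp
  rcases Nat.eq_zero_or_pos p.1 with h | h
  · have : m < p.2 := by omega
    simp [Nat.choose_eq_zero_of_lt this]
  · have hl : (0 : ℚ) < p.1 := by exact_mod_cast h
    refine mul_nonneg (mul_nonneg ?_ (Nat.cast_nonneg _)) (Nat.cast_nonneg _)
    have hq : (0 : ℚ) < (q : ℚ) + 2 := by positivity
    have key : ((q : ℚ) + 2 - (p.1 + 2)) / ((q + 2) * (p.1 + 2))
        - 2 * (((q : ℚ) + 2 - (p.1 + 1)) / ((q + 2) * (p.1 + 1)))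
        + ((q : ℚ) + 2 - p.1) / ((q + 2) * p.1)
        = 2 / ((p.1 : ℚ) * (p.1 + 1) * (p.1 + 2)) := by
      field_simp
      ring
    push_cast
    rw [key]
    positivity

/-- A sequence with monotone differences lies above a line touching it at a given point. -/
theorem exists_supporting_line {f : ℕ → ℚ} {lo hi r : ℕ} (hlr : lo ≤ r) (hrh : r ≤ hi)
    (hf : ∀ u, lo ≤ u → u + 2 ≤ hi → f (u + 1) - f u ≤ f (u + 2) - f (u + 1)) :
    ∃ c : ℚ, ∀ u ∈ Finset.Icc lo hi, f r + c * ((u : ℚ) - r) ≤ f u := by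
  have hmono : ∀ u v, lo ≤ u → u ≤ v → v + 1 ≤ hi → f (u + 1) - f u ≤ f (v + 1) - f v := by
    intro u v hu huv
    induction v, huv using Nat.le_induction with
    | base => exact fun _ => le_rfl
    | succ v huv ih => exact fun hv => (ih (by omega)).trans (hf v (by omega) (by omega))
  obtain ⟨c, hbelow, habove⟩ : ∃ c : ℚ, (∀ v, lo ≤ v → v < r → f (v + 1) - f v ≤ c) ∧
      ∀ v, r ≤ v → v < hi → c ≤ f (v + 1) - f v := by
    rcases hrh.lt_or_eq with h | rfl
    · exact ⟨f (r + 1) - f r, fun v hv hvr => hmono v r hv hvr.le h,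
        fun v hv hvh => hmono r v hlr hv hvh⟩
    · exact ⟨f (r - 1 + 1) - f (r - 1),
        fun v hv hvr => hmono v (r - 1) hv (by omega) (by omega), fun v hv hvh => by omega⟩
  refine ⟨c, fun u hu => ?_⟩
  obtain ⟨hlu, huh⟩ := Finset.mem_Icc.mp hu
  rcases le_total r u with h | h
  · clear hu hlu
    induction u, h using Nat.le_induction with
    | base => simp
    | succ v hv ih =>
      have h₁ := ih (by omega)
      have h₂ := habove v hv (by omega)
      push_cast
      linarith
  · clear hu huh
    induction h using Nat.decreasingInduction with
    | self => simp
    | of_succ v hv ih =>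
      have h₁ := ih (by omega)
      have h₂ := hbelow v hlu hv
      push_cast at h₁
      linarith

/-- Jensen-type bound: let `K, Q` be positive integers with `Q ≤ K`,
and let `a_{K−Q+1},…,a_K` be nonnegative rationals with `N = ∑ a_u > 0` and
`∑ u·a_u = r·N` for an integer `K−Q+1 ≤ r ≤ K`.  Then
`∑ a_u · Z_K^Q(u) ≥ N · Z_K^Q(r)`. -/
theorem Z_jensen (K Q : ℕ) (hK : 0 < K) (hQ : 0 < Q) (hQK : Q ≤ K)
    (a : ℕ → ℚ) (ha : ∀ u ∈ Finset.Icc (K - Q + 1) K, 0 ≤ a u)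
    (N : ℚ) (hN : N = ∑ u ∈ Finset.Icc (K - Q + 1) K, a u) (hNpos : 0 < N)
    (r : ℕ) (hr1 : K - Q + 1 ≤ r) (hr2 : r ≤ K)
    (hmean : ∑ u ∈ Finset.Icc (K - Q + 1) K, (u : ℚ) * a u = (r : ℚ) * N) :
    N * Z K Q r ≤ ∑ u ∈ Finset.Icc (K - Q + 1) K, a u * Z K Q u := by
  obtain ⟨c, hc⟩ := exists_supporting_line hr1 hr2
    (f := Z K Q) fun u hu huK => Z_second_difference_nonneg hQK hu huK
  calc N * Z K Q r
      = N * Z K Q r + c * (∑ u ∈ Finset.Icc (K - Q + 1) K, (u : ℚ) * a u - r * N) := by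
        rw [hmean]
        ring
    _ = ∑ u ∈ Finset.Icc (K - Q + 1) K, a u * (Z K Q r + c * ((u : ℚ) - r)) := by
        rw [hN, Finset.sum_mul, Finset.mul_sum, ← Finset.sum_sub_distrib, Finset.mul_sum,
          ← Finset.sum_add_distrib]
        exact Finset.sum_congr rfl fun u _ => by ring
    _ ≤ ∑ u ∈ Finset.Icc (K - Q + 1) K, a u * Z K Q u :=
        Finset.sum_le_sum fun u hu => mul_le_mul_of_nonneg_left (hc u hu) (ha u hu)
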